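/- Let Γ be a finite simple graph on vertex set {1,…,n} with adjacency matrix A. For each i let s_i be the n×n real matrix of the reflection s_i(e_j) = e_j − (2I − A)_{ij} e_i (so s_i(e_i) = −e_i, s_i(e_j) = e_j + e_i if i,j adjacent, and s_i(e_j) = e_j otherwise), and let c = s_1 s_2 ⋯ s_n be the Coxeter element of the simply-laced Coxeter system associated to Γ. Let U = I − A⁺, where A⁺ is the strictly upper-triangular part of A. Then U is invertible and c = −U⁻¹Uᵀ. -/

import Mathlib

open Real Matrix

/-- The strictly upper-triangular part of a matrix. -/
def strictUpperPart {n : ℕ} (M : Matrix (Fin n) (Fin n) ℝ) : Matrix (Fin n) (Fin n) ℝ :=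
  Matrix.of fun i j => if i < j then M i j else 0

theorem reflection_mul_apply {ι R : Type*} [Fintype ι] [DecidableEq ι] [Ring R]
    {B s : Matrix ι ι R} {i : ι}
    (hs : ∀ r k, s r k = (1 : Matrix ι ι R) r k - if r = i then B i k else 0)
    (P : Matrix ι ι R) (r k : ι) :
    (s * P) r k = P r k - if r = i then (B * P) i k else 0 := by
  simp only [mul_apply, hs, sub_mul, Finset.sum_sub_distrib]
  split_ifs <;> simp [one_apply]

/-- A product of reflections along an increasing list fixes the coordinates outside the list, and
its remaining rows satisfy a recursion: when the reflection in `r` acts, precisely the coordinates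
greater than `r` have already been updated. -/
theorem prod_reflections_apply {ι R : Type*} [Fintype ι] [LinearOrder ι] [Ring R]
    {B : Matrix ι ι R} {S : ι → Matrix ι ι R}
    (hS : ∀ i r k, S i r k = (1 : Matrix ι ι R) r k - if r = i then B i k else 0)
    (l : List ι) (hl : l.Pairwise (· < ·)) (r k : ι) :
    (l.map S).prod r k = (1 : Matrix ι ι R) r k - if r ∈ l then
      ∑ j, B r j * (if r < j then (l.map S).prod j k else (1 : Matrix ι ι R) j k) else 0 := by
  induction l generalizing r with
  | nil => simp
  | cons i l ih =>
    obtain ⟨hi, hl⟩ := List.pairwise_cons.mp hl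
    have ih := ih hl
    rw [List.map_cons, List.prod_cons]
    generalize (l.map S).prod = P at ih ⊢
    have fixed : ∀ j, j ≤ i → P j k = (1 : Matrix ι ι R) j k := fun j hj => by
      rw [ih j, if_neg fun hjl => (hi j hjl).not_ge hj, sub_zero]
    have step := fun j => reflection_mul_apply (hS i) P j k
    by_cases hr : r = i
    · subst hr
      rw [step, if_pos rfl, if_pos List.mem_cons_self, fixed r le_rfl, mul_apply]
      congr 1
      refine Finset.sum_congr rfl fun j _ => ?_
      split_ifs with hj
      · rw [step, if_neg hj.ne', sub_zero]
      · rw [fixed j (not_lt.mp hj)]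
    · rw [step, if_neg hr, sub_zero, ih r]
      simp only [List.mem_cons, hr, false_or]
      split_ifs with hrl
      · congr 1
        refine Finset.sum_congr rfl fun j _ => ?_
        split_ifs with hj
        · rw [step, if_neg ((hi r hrl).trans hj).ne', sub_zero]
        · rfl
      · rfl

theorem det_one_sub_strictUpperPart {n : ℕ} (M : Matrix (Fin n) (Fin n) ℝ) :
    (1 - strictUpperPart M).det = 1 := by
  rw [det_of_isUpperTriangular]
  · simp [strictUpperPart]
  · intro i j hij
    have hij : j < i := hij
    simp [strictUpperPart, one_apply, hij.ne', hij.not_gt]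

theorem simply_laced_coxeter_element_eq_neg_Uinv_mul_Ut
    (n : ℕ) (G : SimpleGraph (Fin n)) [DecidableRel G.Adj]
    (A : Matrix (Fin n) (Fin n) ℝ) (hA : A = G.adjMatrix ℝ)
    (B : Matrix (Fin n) (Fin n) ℝ)
    (hB : B = (2 : ℝ) • (1 : Matrix (Fin n) (Fin n) ℝ) - A)
    (S : Fin n → Matrix (Fin n) (Fin n) ℝ)
    (hS : ∀ i j, (S i).mulVec (Pi.single j 1) =
      (Pi.single j 1 : Fin n → ℝ) - B i j • (Pi.single i 1 : Fin n → ℝ))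
    (c : Matrix (Fin n) (Fin n) ℝ)
    (hc : c = ((List.finRange n).map S).prod)
    (U : Matrix (Fin n) (Fin n) ℝ)
    (hU : U = 1 - strictUpperPart A) :
    IsUnit U ∧ c = -(U⁻¹ * Uᵀ) := by
  have hdet : IsUnit U.det := by simp [hU, det_one_sub_strictUpperPart]
  refine ⟨(isUnit_iff_isUnit_det U).mpr hdet, ?_⟩
  have hS' : ∀ i r k, S i r k = (1 : Matrix (Fin n) (Fin n) ℝ) r k - if r = i then B i k else 0 := by
    intro i r k
    have h := congrFun (hS i k) r
    simpa [mulVec_single_one, Pi.single_apply, one_apply] using h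
  have hsymm : ∀ i j, A i j = A j i := fun i j => by
    simp [hA, SimpleGraph.adjMatrix_apply, G.adj_comm]
  have hdiag : ∀ i, A i i = 0 := fun i => by simp [hA]
  have hUc : U * c = -Uᵀ := by
    ext r k
    have hrow := prod_reflections_apply hS' (List.finRange n) (List.pairwise_lt_finRange n) r k
    rw [← hc, if_pos (List.mem_finRange r)] at hrow
    have hsplit : ∑ j, B r j * (if r < j then c j k else (1 : Matrix (Fin n) (Fin n) ℝ) j k)
        = ((U - 1) * c) r k + (1 + Uᵀ) r k := by
      rw [← mul_one (1 + Uᵀ), mul_apply, mul_apply, ← Finset.sum_add_distrib]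
      refine Finset.sum_congr rfl fun j _ => ?_
      rcases lt_trichotomy r j with h | rfl | h
      · simp [hB, hU, strictUpperPart, one_apply, h, h.ne, h.not_gt]
      · simp [hB, hU, strictUpperPart, one_apply, hdiag]
        norm_num
      · simp [hB, hU, strictUpperPart, one_apply, h, h.ne', h.not_gt, hsymm r j]
    rw [hsplit, sub_mul, one_mul, Matrix.sub_apply, Matrix.add_apply] at hrow
    rw [Matrix.neg_apply]
    linarith
  rw [← mul_neg, ← hUc, nonsing_inv_mul_cancel_left _ _ hdet]
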